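/- arXiv:2012.09621 — 2 statements merged into one kernel-verified Lean document; each statement's English description precedes it below -/
import Mathlib

section
/- For all L > 0, μ > 0 and e > 0: (1/L²) Σ_{k ∈ Λ_L, |k|² > μ} 1/(|k|² − μ + e)² ≤ 1/(4πe) + 1/(L e^{3/2}) + (4√μ/L + 6/L²)·(1/e²). -/
open Real MeasureTheory Set

/-- The momentum lattice point `(2π/L)·z` for `z ∈ ℤ²`. -/
noncomputable def kvec (L : ℝ) (z : ℤ × ℤ) : ℝ × ℝ :=
  ((2 * Real.pi / L) * z.1, (2 * Real.pi / L) * z.2)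

/-- Euclidean norm squared on `ℝ²`. -/
noncomputable def nsq (v : ℝ × ℝ) : ℝ := v.1 ^ 2 + v.2 ^ 2

/-- The half-open unit square centred at the lattice point `z`. -/
def unitCell (z : ℤ × ℤ) : Set ℂ :=
  Complex.measurableEquivRealProd ⁻¹'
    (Ico ((z.1 : ℝ) - 1 / 2) (z.1 + 1 / 2) ×ˢ Ico ((z.2 : ℝ) - 1 / 2) (z.2 + 1 / 2))

lemma mem_unitCell {z : ℤ × ℤ} {x : ℂ} : x ∈ unitCell z ↔
    ((z.1 : ℝ) - 1 / 2 ≤ x.re ∧ x.re < z.1 + 1 / 2) ∧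
      ((z.2 : ℝ) - 1 / 2 ≤ x.im ∧ x.im < z.2 + 1 / 2) := by
  simp [unitCell, Complex.measurableEquivRealProd_apply]

lemma measurableSet_unitCell (z : ℤ × ℤ) : MeasurableSet (unitCell z) :=
  Complex.measurableEquivRealProd.measurable (measurableSet_Ico.prod measurableSet_Ico)

lemma volume_unitCell (z : ℤ × ℤ) : volume (unitCell z) = 1 := by
  rw [unitCell, Complex.volume_preserving_equiv_real_prod.measure_preimage
    (measurableSet_Ico.prod measurableSet_Ico).nullMeasurableSet, Measure.volume_eq_prod,
    Measure.prod_prod, Real.volume_Ico, Real.volume_Ico]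
  ring_nf
  simp

lemma pairwiseDisjoint_unitCell (s : Set (ℤ × ℤ)) : s.PairwiseDisjoint unitCell := by
  intro z _ w _ hzw
  refine Set.disjoint_left.2 fun x hx hy => hzw ?_
  rw [mem_unitCell] at hx hy
  obtain ⟨⟨h1, h2⟩, h3, h4⟩ := hx
  obtain ⟨⟨g1, g2⟩, g3, g4⟩ := hy
  have a1 : (z.1 : ℝ) < w.1 + 1 := by linarith
  have a2 : (w.1 : ℝ) < z.1 + 1 := by linarith
  have a3 : (z.2 : ℝ) < w.2 + 1 := by linarith
  have a4 : (w.2 : ℝ) < z.2 + 1 := by linarith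
  norm_cast at a1 a2 a3 a4
  ext <;> omega

lemma norm_sub_lt_one_of_mem_unitCell {z : ℤ × ℤ} {x : ℂ} (hx : x ∈ unitCell z) :
    ‖x - ⟨z.1, z.2⟩‖ < 1 := by
  rw [mem_unitCell] at hx
  obtain ⟨⟨h1, h2⟩, h3, h4⟩ := hx
  rw [← sq_lt_one_iff₀ (norm_nonneg _), Complex.sq_norm, Complex.normSq_apply]
  simp only [Complex.sub_re, Complex.sub_im]
  nlinarith

/-- An upper bound for the number of integer points in an annulus. -/
lemma card_le_of_forall_mem_annulus (T : Finset (ℤ × ℤ)) {r R : ℝ} (hr : 0 ≤ r) (hrR : r ≤ R)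
    (hT : ∀ z ∈ T, r ^ 2 ≤ (z.1 : ℝ) ^ 2 + (z.2 : ℝ) ^ 2 ∧
      (z.1 : ℝ) ^ 2 + (z.2 : ℝ) ^ 2 ≤ R ^ 2) :
    (T.card : ℝ) ≤ π * (R ^ 2 - r ^ 2) + 2 * π * (R + r) + π := by
  have hsub : (⋃ z ∈ T, unitCell z) ⊆ Metric.ball (0 : ℂ) (R + 1) \ Metric.ball 0 (r - 1) := by
    refine iUnion₂_subset fun z hz x hx => ?_
    obtain ⟨h1, h2⟩ := hT z hz
    have hlt := norm_sub_lt_one_of_mem_unitCell hx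
    have hn : ‖(⟨z.1, z.2⟩ : ℂ)‖ ^ 2 = (z.1 : ℝ) ^ 2 + (z.2 : ℝ) ^ 2 := by
      rw [Complex.sq_norm, Complex.normSq_apply]; ring
    rw [← hn] at h1 h2
    have h1' := le_of_sq_le_sq h1 (norm_nonneg _)
    have h2' := le_of_sq_le_sq h2 (hr.trans hrR)
    have t1 := norm_le_norm_add_norm_sub' x (⟨z.1, z.2⟩ : ℂ)
    have t2 := norm_le_norm_add_norm_sub x (⟨z.1, z.2⟩ : ℂ)
    simp only [mem_sdiff, Metric.mem_ball, dist_zero_right, not_lt]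
    constructor <;> linarith
  have hcard : volume (⋃ z ∈ T, unitCell z) = T.card := by
    rw [measure_biUnion_finset (pairwiseDisjoint_unitCell _) fun z _ => measurableSet_unitCell z]
    simp [volume_unitCell]
  have hball : ∀ ρ : ℝ, volume.real (Metric.ball (0 : ℂ) ρ) = max ρ 0 ^ 2 * π := by
    intro ρ
    simp [Measure.real, Complex.volume_ball, ENNReal.toReal_ofReal']
  have hle := measureReal_mono (μ := volume) hsub
    (measure_ne_top_of_subset sdiff_subset measure_ball_lt_top.ne)
  rw [measureReal_sdiff (Metric.ball_subset_ball (by linarith)) measurableSet_ball, hball, hball,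
    Measure.real, hcard, ENNReal.toReal_natCast, max_eq_left (by linarith : 0 ≤ R + 1)] at hle
  have hmax : r ^ 2 - 2 * r ≤ max (r - 1) 0 ^ 2 := by
    rcases le_total (r - 1) 0 with h | h
    · rw [max_eq_right h]; nlinarith
    · rw [max_eq_left h]; nlinarith
  nlinarith [Real.pi_pos]

lemma integrableOn_and_integral_Ioi_of_deriv {F f : ℝ → ℝ} {a : ℝ}
    (hF : ∀ t ∈ Ici a, HasDerivAt F (f t) t) (hf : ∀ t ∈ Ioi a, 0 ≤ f t)
    (hlim : Filter.Tendsto F Filter.atTop (nhds 0)) :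
    IntegrableOn f (Ioi a) ∧ ∫ t in Ioi a, f t = -F a :=
  ⟨integrableOn_Ioi_deriv_of_nonneg' hF hf hlim, by
    rw [integral_Ioi_of_hasDerivAt_of_nonneg' hF hf hlim, zero_sub]⟩

lemma tendsto_const_div_add_pow (c e : ℝ) {n : ℕ} (hn : n ≠ 0) :
    Filter.Tendsto (fun t : ℝ => c / (t + e) ^ n) Filter.atTop (nhds 0) :=
  Filter.Tendsto.const_div_atTop
    ((Filter.tendsto_pow_atTop hn).comp (Filter.tendsto_atTop_add_const_right _ _ Filter.tendsto_id))
    c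

lemma hasDerivAt_inv_add_sq {e t : ℝ} (h : t + e ≠ 0) :
    HasDerivAt (fun t : ℝ => -1 / (t + e) ^ 2) (2 / (t + e) ^ 3) t := by
  refine ((hasDerivAt_const t (-1 : ℝ)).fun_div (((hasDerivAt_id t).add_const e).fun_pow 2)
    (pow_ne_zero 2 h)).congr_deriv ?_
  simp
  field_simp

lemma hasDerivAt_inv_add {e t : ℝ} (h : t + e ≠ 0) :
    HasDerivAt (fun t : ℝ => -1 / (t + e) ^ 1) (1 / (t + e) ^ 2) t := by
  refine ((hasDerivAt_const t (-1 : ℝ)).fun_div (((hasDerivAt_id t).add_const e).fun_pow 1)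
    (pow_ne_zero 1 h)).congr_deriv ?_
  simp

lemma integral_Ioi_two_div_add_cube {a e : ℝ} (ha : 0 ≤ a) (he : 0 < e) :
    IntegrableOn (fun t : ℝ => 2 / (t + e) ^ 3) (Ioi a) ∧
      ∫ t in Ioi a, 2 / (t + e) ^ 3 = 1 / (a + e) ^ 2 := by
  have := integrableOn_and_integral_Ioi_of_deriv (a := a) (f := fun t : ℝ => 2 / (t + e) ^ 3)
    (fun t ht => hasDerivAt_inv_add_sq (e := e) (by have : a ≤ t := ht; exact (by linarith : 0 < t + e).ne'))
    (fun t ht => by have : 0 < t := ha.trans_lt ht; positivity) (tendsto_const_div_add_pow _ e two_ne_zero)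
  refine ⟨this.1, this.2.trans ?_⟩
  ring

lemma integral_Ioi_one_div_add_sq {e : ℝ} (he : 0 < e) :
    IntegrableOn (fun t : ℝ => 1 / (t + e) ^ 2) (Ioi 0) ∧
      ∫ t in Ioi (0 : ℝ), 1 / (t + e) ^ 2 = 1 / e := by
  have := integrableOn_and_integral_Ioi_of_deriv (a := 0) (f := fun t : ℝ => 1 / (t + e) ^ 2)
    (fun t ht => hasDerivAt_inv_add (e := e) (by have : 0 ≤ t := ht; positivity))
    (fun t ht => by have : 0 < t := ht; positivity) (tendsto_const_div_add_pow _ e one_ne_zero)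
  refine ⟨this.1, this.2.trans ?_⟩
  ring

/-- A linear bound on a counting function bounds the associated sum of inverse squares. -/
lemma sum_one_div_add_sq_le {ι : Type*} (T : Finset ι) (d : ι → ℝ) {e α β : ℝ} (he : 0 < e)
    (hd : ∀ i ∈ T, 0 ≤ d i)
    (hcount : ∀ t : ℝ, 0 < t → ((T.filter fun i => d i < t).card : ℝ) ≤ α * t + β) :
    ∑ i ∈ T, 1 / (d i + e) ^ 2 ≤ α / e + β / e ^ 2 := by
  set g : ℝ → ℝ := fun t => 2 / (t + e) ^ 3 with hg
  have hg0 := integral_Ioi_two_div_add_cube le_rfl he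
  have hg1 := integral_Ioi_one_div_add_sq he
  have hterm : ∀ i ∈ T, 1 / (d i + e) ^ 2 = ∫ t in Ioi 0, (Ioi (d i)).indicator g t := by
    intro i hi
    rw [setIntegral_indicator measurableSet_Ioi, Ioi_inter_Ioi, max_eq_right (hd i hi)]
    exact (integral_Ioi_two_div_add_cube (hd i hi) he).2.symm
  have hint : ∀ i ∈ T, IntegrableOn ((Ioi (d i)).indicator g) (Ioi 0) := fun i _ =>
    hg0.1.indicator measurableSet_Ioi
  have hbound : ∀ t ∈ Ioi (0 : ℝ), ∑ i ∈ T, (Ioi (d i)).indicator g t ≤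
      2 * α * (1 / (t + e) ^ 2) + (β - α * e) * g t := by
    intro t ht
    have ht' : 0 < t := ht
    have hsum : ∑ i ∈ T, (Ioi (d i)).indicator g t = (T.filter fun i => d i < t).card * g t := by
      simp only [Set.indicator_apply, mem_Ioi]
      rw [← Finset.sum_filter, Finset.sum_const, nsmul_eq_mul]
    have hgt : 0 ≤ g t := by simp only [hg]; positivity
    rw [hsum]
    refine (mul_le_mul_of_nonneg_right (hcount t ht') hgt).trans_eq ?_
    simp only [hg]
    field_simp
    ring
  have hint' : IntegrableOn (fun t => 2 * α * (1 / (t + e) ^ 2) + (β - α * e) * g t) (Ioi 0) :=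
    (hg1.1.const_mul _).add (hg0.1.const_mul _)
  calc ∑ i ∈ T, 1 / (d i + e) ^ 2
      = ∫ t in Ioi 0, ∑ i ∈ T, (Ioi (d i)).indicator g t := by
        rw [integral_finsetSum _ hint]
        exact Finset.sum_congr rfl hterm
    _ ≤ ∫ t in Ioi 0, (2 * α * (1 / (t + e) ^ 2) + (β - α * e) * g t) :=
        setIntegral_mono_on (integrable_finsetSum _ hint) hint' measurableSet_Ioi hbound
    _ = α / e + β / e ^ 2 := by
        rw [integral_add (hg1.1.const_mul _) (hg0.1.const_mul _), integral_const_mul,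
          integral_const_mul, hg1.2, hg0.2]
        field_simp
        ring

/-- An upper bound for the number of momentum lattice points in an energy shell. -/
lemma card_le_of_forall_nsq_kvec_mem {L μ t : ℝ} (hL : 0 < L) (hμ : 0 ≤ μ) (ht : 0 ≤ t)
    (T : Finset (ℤ × ℤ)) (hT : ∀ z ∈ T, μ ≤ nsq (kvec L z) ∧ nsq (kvec L z) ≤ μ + t) :
    (T.card : ℝ) ≤ L ^ 2 / (4 * π) * t + L * (2 * √μ + √t) + π := by
  have hπ := Real.pi_pos
  have hc : 0 < L / (2 * π) := by positivity
  have hnsq : ∀ z : ℤ × ℤ, (z.1 : ℝ) ^ 2 + (z.2 : ℝ) ^ 2 =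
      (L / (2 * π)) ^ 2 * nsq (kvec L z) := by
    intro z
    simp only [nsq, kvec]
    field_simp
  have h := card_le_of_forall_mem_annulus T (r := L / (2 * π) * √μ) (R := L / (2 * π) * √(μ + t))
    (by positivity) (by gcongr; linarith) (fun z hz => by
      rw [hnsq, mul_pow, mul_pow, Real.sq_sqrt hμ, Real.sq_sqrt (by positivity)]
      exact ⟨by gcongr; exact (hT z hz).1, by gcongr; exact (hT z hz).2⟩)
  have hs : √(μ + t) ≤ √μ + √t := by
    rw [Real.sqrt_le_iff]
    refine ⟨by positivity, ?_⟩
    nlinarith [Real.sq_sqrt hμ, Real.sq_sqrt ht,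
      mul_nonneg (Real.sqrt_nonneg μ) (Real.sqrt_nonneg t)]
  rw [mul_pow, mul_pow, Real.sq_sqrt hμ, Real.sq_sqrt (by positivity)] at h
  have e1 : π * ((L / (2 * π)) ^ 2 * (μ + t) - (L / (2 * π)) ^ 2 * μ) = L ^ 2 / (4 * π) * t := by
    field_simp
    ring
  have e2 : 2 * π * (L / (2 * π) * √(μ + t) + L / (2 * π) * √μ) = L * (√(μ + t) + √μ) := by
    field_simp
  rw [e1, e2] at h
  nlinarith

theorem stmt_12 (L μ e : ℝ) (hL : 0 < L) (hμ : 0 < μ) (he : 0 < e) :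
    Summable (fun z : ℤ × ℤ =>
      if μ < nsq (kvec L z) then 1 / (nsq (kvec L z) - μ + e) ^ 2 else 0) ∧
    (1 / L ^ 2) * (∑' z : ℤ × ℤ,
        if μ < nsq (kvec L z) then 1 / (nsq (kvec L z) - μ + e) ^ 2 else 0)
      ≤ 1 / (4 * π * e) + 1 / (L * e ^ ((3 : ℝ) / 2))
        + (4 * Real.sqrt μ / L + 6 / L ^ 2) * (1 / e ^ 2) := by
  have hπ := Real.pi_pos
  have hse : 0 < √e := Real.sqrt_pos.2 he
  set α := L ^ 2 / (4 * π) + L / (2 * √e) with hα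
  set β := L * √e / 2 + 2 * L * √μ + π with hβ
  have hsum : ∀ T : Finset (ℤ × ℤ), ∑ z ∈ T,
      (if μ < nsq (kvec L z) then 1 / (nsq (kvec L z) - μ + e) ^ 2 else 0) ≤
        α / e + β / e ^ 2 := by
    intro T
    rw [← Finset.sum_filter]
    refine sum_one_div_add_sq_le _ (fun z => nsq (kvec L z) - μ) he
      (fun z hz => by linarith [(Finset.mem_filter.1 hz).2]) fun t ht => ?_
    refine (card_le_of_forall_nsq_kvec_mem hL hμ.le ht.le _ fun z hz => ?_).trans ?_
    · simp only [Finset.mem_filter] at hz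
      constructor <;> linarith
    · have hst : √t ≤ t / (2 * √e) + √e / 2 := by
        have : t / (2 * √e) + √e / 2 - √t = (√t - √e) ^ 2 / (2 * √e) := by
          field_simp
          nlinarith [Real.sq_sqrt ht.le]
        have : 0 ≤ (√t - √e) ^ 2 / (2 * √e) := by positivity
        linarith
      have := mul_le_mul_of_nonneg_left hst hL.le
      calc _ ≤ L ^ 2 / (4 * π) * t + (2 * L * √μ + L * (t / (2 * √e) + √e / 2)) + π := by linarith
        _ = α * t + β := by rw [hα, hβ]; ring
  have hnonneg : ∀ z : ℤ × ℤ,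
      0 ≤ (if μ < nsq (kvec L z) then 1 / (nsq (kvec L z) - μ + e) ^ 2 else 0) := by
    intro z
    split_ifs <;> positivity
  refine ⟨summable_of_sum_le hnonneg hsum, ?_⟩
  have hrpow : e ^ ((3 : ℝ) / 2) = √e ^ 3 := by
    rw [Real.sqrt_eq_rpow, ← Real.rpow_natCast, ← Real.rpow_mul he.le]
    norm_num
  have hsq : √e ^ 2 = e := Real.sq_sqrt he.le
  calc _ ≤ 1 / L ^ 2 * (α / e + β / e ^ 2) := by
        gcongr
        exact Real.tsum_le_of_sum_le hnonneg hsum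
    _ = 1 / (4 * π * e) + 1 / (L * e ^ ((3 : ℝ) / 2)) +
        (2 * √μ / L + π / L ^ 2) * (1 / e ^ 2) := by
        rw [hα, hβ, hrpow]
        generalize √e = s at *
        subst hsq
        field_simp
        ring
    _ ≤ _ := by
        gcongr
        · norm_num
        · linarith [Real.pi_lt_four]
end

section
/- Let L > 0, μ > 0 and Θ > 0. For every finite subset S ⊂ Λ_L with card S = N(μ) − 1, setting n = card{k ∈ S : |k|² > Θ}, one has Σ_{k ∈ S, |k|² ≤ Θ} |k|² ≥ E₀(μ) − (n+1)μ. -/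
open Real MeasureTheory Set

/-- The free Fermi energy `E₀(μ) = Σ_{|k|² ≤ μ} |k|²`. -/
noncomputable def E0 (L μ : ℝ) : ℝ :=
  ∑' z : ℤ × ℤ, if nsq (kvec L z) ≤ μ then nsq (kvec L z) else 0

/-- The particle number `N(μ) = card{k ∈ Λ_L : |k|² ≤ μ}`. -/
noncomputable def Nmu (L μ : ℝ) : ℕ := Nat.card {z : ℤ × ℤ // nsq (kvec L z) ≤ μ}

theorem nsq_kvec (L : ℝ) (z : ℤ × ℤ) :
    nsq (kvec L z) = (2 * Real.pi / L) ^ 2 * ((z.1 : ℝ) ^ 2 + (z.2 : ℝ) ^ 2) := by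
  simp only [nsq, kvec]
  ring

theorem Int.mem_Icc_of_sq_le {a : ℤ} {r : ℝ} (h : (a : ℝ) ^ 2 ≤ r) :
    a ∈ Set.Icc (-⌈r⌉) ⌈r⌉ := by
  have h' : a ^ 2 ≤ ⌈r⌉ := by exact_mod_cast h.trans (Int.le_ceil r)
  exact abs_le.mp ((Int.le_self_sq |a|).trans (by rwa [sq_abs]))

theorem finite_nsq_kvec_le {L : ℝ} (hL : 0 < L) (μ : ℝ) :
    {z : ℤ × ℤ | nsq (kvec L z) ≤ μ}.Finite := by
  have hc : 0 < (2 * Real.pi / L) ^ 2 := by positivity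
  set r := μ / (2 * Real.pi / L) ^ 2
  refine ((Set.finite_Icc (-⌈r⌉) ⌈r⌉).prod (Set.finite_Icc (-⌈r⌉) ⌈r⌉)).subset fun z hz => ?_
  rw [Set.mem_ofPred_eq, nsq_kvec, mul_comm, ← le_div_iff₀ hc] at hz
  exact ⟨Int.mem_Icc_of_sq_le ((le_add_of_nonneg_right (sq_nonneg _)).trans hz),
    Int.mem_Icc_of_sq_le ((le_add_of_nonneg_left (sq_nonneg _)).trans hz)⟩

/-- Among all finite sets, the sublevel set `{f ≤ μ}` minimizes `∑ (f - μ)`. -/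
theorem Finset.sum_sub_le_sum_sub_of_mem_iff_le {ι : Type*} [DecidableEq ι] {f : ι → ℝ} {μ : ℝ}
    {B : Finset ι} (hB : ∀ i, i ∈ B ↔ f i ≤ μ) (T : Finset ι) :
    ∑ i ∈ B, (f i - μ) ≤ ∑ i ∈ T, (f i - μ) := by
  rw [← Finset.sum_inter_add_sum_sdiff B T, ← Finset.sum_inter_add_sum_sdiff T B,
    Finset.inter_comm T B]
  have h₁ : ∑ i ∈ B \ T, (f i - μ) ≤ 0 := Finset.sum_nonpos fun i hi =>
    sub_nonpos.mpr ((hB i).mp (Finset.mem_sdiff.mp hi).1)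
  have h₂ : 0 ≤ ∑ i ∈ T \ B, (f i - μ) := Finset.sum_nonneg fun i hi =>
    sub_nonneg.mpr (not_le.mp (mt (hB i).mpr (Finset.mem_sdiff.mp hi).2)).le
  linarith

open Classical in
theorem stmt_13 (L μ Θ : ℝ) (hL : 0 < L) (hμ : 0 < μ) (hΘ : 0 < Θ)
    (S : Finset (ℤ × ℤ)) (hS : S.card = Nmu L μ - 1) :
    E0 L μ - (((S.filter (fun z => Θ < nsq (kvec L z))).card : ℝ) + 1) * μ
      ≤ ∑ z ∈ S.filter (fun z => nsq (kvec L z) ≤ Θ), nsq (kvec L z) := by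
  have hfin := finite_nsq_kvec_le hL μ
  set B := hfin.toFinset
  have hB : ∀ z, z ∈ B ↔ nsq (kvec L z) ≤ μ := fun z => by simp [B]
  have hE : E0 L μ = ∑ z ∈ B, nsq (kvec L z) := by
    rw [E0, tsum_eq_sum (s := B) fun z hz => if_neg (mt (hB z).mpr hz)]
    exact Finset.sum_congr rfl fun z hz => if_pos ((hB z).mp hz)
  have hN : Nmu L μ = B.card := Nat.card_eq_card_finite_toFinset hfin
  have hpos : 0 < B.card :=
    Finset.card_pos.mpr ⟨0, (hB 0).mpr (by simpa [nsq_kvec] using hμ.le)⟩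
  have hsplit := S.card_filter_add_card_filter_not (fun z => nsq (kvec L z) ≤ Θ)
  simp only [not_le] at hsplit
  have hcard : ((S.filter fun z => nsq (kvec L z) ≤ Θ).card : ℝ)
      + (S.filter fun z => Θ < nsq (kvec L z)).card + 1 = B.card := by
    norm_cast
    omega
  have key := Finset.sum_sub_le_sum_sub_of_mem_iff_le hB
    (S.filter fun z => nsq (kvec L z) ≤ Θ)
  simp only [Finset.sum_sub_distrib, Finset.sum_const, nsmul_eq_mul] at key
  rw [hE]
  rw [← hcard] at key
  linarith
end
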